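/- Let j ≥ 1 and d ≥ 1 be integers with Nd ≥ j − 1, and write Nd + 1 − j = N(d − l) + i with integers 0 ≤ i ≤ N−1 and 0 ≤ l ≤ d − 1. Let L_m^{σ²} denote the element obtained from the defining formula of L_m by replacing η throughout by η^{q²}. Then L_{Nd+1}^{σ²} / (L_{Nd+1−j}^{σ²})^{q^j} = (⟨1⟩⋯⟨N−1⟩)^{1−q^j} · ⟨N⟩^{W_j} · ((θ − η)/(θ − η^{q}))^{q^j − 1} · ((θ − η)/(θ − η^{q²}))^{W_j} · ( ∏_{k=0}^{i} Γ_{d−l,k} · ∏_{k=i+1}^{N−1} Γ_{d−l−1,k} )^{q^j} / ( Γ_{d,0} · Γ_{d,1} · ∏_{k=2}^{N−1} Γ_{d−1,k} ). (This is the finite identity whose limit as d → ∞ defines the Carlitz period π̃ of the twisted module Ψ^{(2)}.) -/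

import Mathlib

open Finset

theorem prod_Icc_one_eq_prod_range {M : Type*} [CommMonoid M] (f : ℕ → M) (n : ℕ) :
    ∏ m ∈ Icc 1 n, f m = ∏ m ∈ range n, f (m + 1) := by
  rw [← Ico_add_one_right_eq_Icc, prod_Ico_eq_prod_range, Nat.add_sub_cancel]
  simp only [add_comm 1]

/-- The geometric sum `1 + q + ⋯` with `j + a` terms, split after `j` terms. -/
theorem geom_sum_add_eq (q j a : ℕ) :
    ∑ k ∈ range (j + a), q ^ k = ∑ k ∈ range j, q ^ k + q ^ j * ∑ k ∈ range a, q ^ k := by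
  rw [sum_range_add, mul_sum]
  simp only [pow_add]

/-- A product of consecutive values of a periodic function, grouped by residue class. -/
theorem prod_range_eq_prod_pow_of_periodic {M : Type*} [CommMonoid M] {N : ℕ} (hN : 0 < N)
    (f : ℕ → M) (hf : Function.Periodic f N) (n : ℕ) :
    ∏ t ∈ range n, f t = ∏ k ∈ range N, f k ^ ((n + N - k - 1) / N) := by
  induction n with
  | zero =>
    refine (prod_eq_one fun k hk => ?_).symm
    rw [Nat.div_eq_of_lt (by omega), pow_zero]
  | succ n ih =>
    have step : ∀ k ∈ range N, f k ^ ((n + 1 + N - k - 1) / N)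
        = f k ^ ((n + N - k - 1) / N) * if k = n % N then f k else 1 := by
      intro k hk
      rw [mem_range] at hk
      have hdvd : N ∣ n + N - k - 1 + 1 ↔ k = n % N := by
        rw [show n + N - k - 1 + 1 = n + N - k by omega,
          ← Nat.modEq_iff_dvd' (by omega), Nat.ModEq, Nat.add_mod_right, Nat.mod_eq_of_lt hk]
      rw [show n + 1 + N - k - 1 = n + N - k - 1 + 1 by omega, Nat.succ_div, pow_add]
      simp only [hdvd]
      split_ifs <;> simp
    rw [prod_congr rfl step, prod_mul_distrib, ← ih, prod_range_succ, prod_ite_eq',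
      if_pos (mem_range.2 (Nat.mod_lt n hN)), hf.map_mod_nat]

/-- A product over `D` full blocks of length `N`, taken column by column. -/
theorem prod_range_mul_eq_prod_prod {M : Type*} [CommMonoid M] (N D : ℕ) (h : ℕ → M) :
    ∏ k ∈ range N, ∏ t ∈ range D, h (N * t + k) = ∏ m ∈ range (N * D), h m := by
  induction D with
  | zero => simp
  | succ D ih => simp only [prod_range_succ, prod_mul_distrib, ih, Nat.mul_succ, prod_range_add]

/-- A product over `D` full blocks of length `N` and `i + 1` further terms, taken column by
column. -/
theorem prod_range_mul_add_eq_prod_prod {M : Type*} [CommMonoid M] {N i : ℕ} (hi : i + 1 ≤ N)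
    (D : ℕ) (h : ℕ → M) :
    (∏ k ∈ range (i + 1), ∏ t ∈ range (D + 1), h (N * t + k))
        * ∏ k ∈ Ico (i + 1) N, ∏ t ∈ range D, h (N * t + k)
      = ∏ m ∈ range (N * D + (i + 1)), h m := by
  simp only [prod_range_succ _ D, prod_mul_distrib]
  rw [mul_right_comm, prod_range_mul_prod_Ico _ hi, prod_range_mul_eq_prod_prod,
    prod_range_add _ (N * D)]

/-- The finite identity for `L^{σ²}`-quotients whose limit as
`d → ∞` defines the Carlitz period of the twisted module `Ψ^{(2)}`. -/
theorem drinfeld_period_finite_identity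
    (p q N : ℕ) (hp : Nat.Prime p) (hq : ∃ e : ℕ, 0 < e ∧ q = p ^ e)
    (hN : 2 ≤ N)
    (F : Type*) [Field F] [CharP F p]
    (θ η : F) (hη : η ≠ 0) (hper : η ^ q ^ N = η)
    (hθη : ∀ a b : ℕ, θ ^ q ^ a ≠ η ^ q ^ b)
    (hθ : ∀ m : ℕ, 1 ≤ m → θ ^ q ^ m ≠ θ)
    (W : ℕ → ℕ) (hW : ∀ i, W i = (q ^ i - 1) / (q - 1))
    (br : ℕ → F) (hbr : ∀ m : ℕ, br m = ((θ - η) ^ q ^ m)⁻¹ - (θ - η ^ q ^ m)⁻¹)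
    (Γ : ℕ → ℕ → F)
    (hΓ : ∀ d k : ℕ, Γ d k
      = ∏ j ∈ Finset.Icc 1 d, (1 - br (N * (j - 1) + k) / br (N * j + k)))
    -- the coefficients L_j, parameterized by the element substituted for η
    (Lf : F → ℕ → F) (hLf0 : ∀ e : F, Lf e 0 = 1)
    (hLf : ∀ (e : F) (j : ℕ), 1 ≤ j → Lf e j
      = (∏ m ∈ Finset.Icc 1 j, (θ - θ ^ q ^ m))
        * ((θ - e) ^ W j)⁻¹
        * ((θ - e ^ q ^ (N - 1)) ^ q ^ j)⁻¹
        * ∏ k ∈ Finset.range N, ((θ - e ^ q ^ k) ^ ((j + N - k - 2) / N))⁻¹)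
    (j d l i : ℕ) (hj : 1 ≤ j) (hd : 1 ≤ d) (hNd : j - 1 ≤ N * d)
    (hi : i ≤ N - 1) (hl : l ≤ d - 1)
    (hdecomp : N * d + 1 - j = N * (d - l) + i) :
    Lf (η ^ q ^ 2) (N * d + 1) / (Lf (η ^ q ^ 2) (N * d + 1 - j)) ^ q ^ j
      = (∏ m ∈ Finset.Icc 1 (N - 1), br m) ^ ((1 : ℤ) - (q : ℤ) ^ j)
        * br N ^ W j
        * ((θ - η) / (θ - η ^ q)) ^ (q ^ j - 1)
        * ((θ - η) / (θ - η ^ q ^ 2)) ^ W j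
        * ((∏ k ∈ Finset.range (i + 1), Γ (d - l) k)
            * ∏ k ∈ Finset.Icc (i + 1) (N - 1), Γ (d - l - 1) k) ^ q ^ j
        / (Γ d 0 * Γ d 1 * ∏ k ∈ Finset.Icc 2 (N - 1), Γ (d - 1) k) := by
  obtain ⟨e, he, rfl⟩ := hq
  have : Fact p.Prime := ⟨hp⟩
  set q := p ^ e with hqdef
  have hq2 : 2 ≤ q := hp.two_le.trans (Nat.le_self_pow he.ne' p)
  have hfrob : ∀ (x y : F) (m : ℕ), (x - y) ^ q ^ m = x ^ q ^ m - y ^ q ^ m := by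
    intro x y m
    rw [hqdef, ← pow_mul, sub_pow_char_pow]
  clear_value q
  have hWsum : ∀ n, W n = ∑ k ∈ range n, q ^ k := fun n => by
    rw [hW, Nat.geomSum_eq hq2]
  have hWadd : ∀ j a, W (j + a) = W j + q ^ j * W a := fun j a => by
    simp only [hWsum, geom_sum_add_eq]
  have hqW : ∀ j, q * W j = W j + (q ^ j - 1) := fun j => by
    have h1 := hWadd 1 j
    have h2 := hWadd j 1
    have hW1 : W 1 = 1 := by simp [hWsum]
    rw [add_comm 1 j, hW1, pow_one] at h1
    rw [hW1] at h2
    have := Nat.one_le_pow j q (by omega)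
    omega
  have hshift : ∀ m, η ^ q ^ (m + N) = η ^ q ^ m := fun m => by
    rw [add_comm, pow_add, pow_mul, hper]
  have hne : ∀ m, θ - η ^ q ^ m ≠ 0 := fun m => sub_ne_zero.2 (by simpa using hθη 0 m)
  have hne0 : θ - η ≠ 0 := by simpa using hne 0
  have hbrdiv : ∀ m, br m = (θ - θ ^ q ^ m) / ((θ - η) ^ q ^ m * (θ - η ^ q ^ m)) := fun m => by
    rw [hbr, inv_sub_inv (pow_ne_zero _ hne0) (hne m), hfrob]
    congr 1
    ring
  have hbrne : ∀ m, 1 ≤ m → br m ≠ 0 := fun m hm => by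
    rw [hbrdiv]
    exact div_ne_zero (sub_ne_zero.2 (hθ m hm).symm) (mul_ne_zero (pow_ne_zero _ hne0) (hne m))
  have hfactor : ∀ m, 1 - br m / br (m + N) = br N ^ q ^ m / br (m + N) := fun m => by
    rw [one_sub_div (hbrne _ (by omega))]
    congr 1
    rw [hbr, hbr, hbr N, hshift, hper, hfrob (_)⁻¹ _ m, inv_pow, inv_pow, ← pow_mul, ← pow_add,
      add_comm N m]
    ring
  let B : ℕ → F := fun n => ∏ m ∈ range n, br (m + 1)
  have hBne : ∀ n, B n ≠ 0 := fun n => prod_ne_zero_iff.2 fun m _ => hbrne _ (by omega)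
  have hA : ∏ m ∈ Icc 1 (N - 1), br m = B (N - 1) := prod_Icc_one_eq_prod_range br _
  have hΓrange : ∀ D k, Γ D k = ∏ t ∈ range D, (1 - br (N * t + k) / br (N * t + k + N)) := by
    intro D k
    rw [hΓ, prod_Icc_one_eq_prod_range]
    simp only [Nat.add_sub_cancel, mul_add, mul_one,
      add_right_comm _ N k]
  have hprod : ∀ M, ∏ m ∈ range M, (1 - br m / br (m + N))
      = br N ^ W M * B (N - 1) / B (N - 1 + M) := fun M => by
    have hB : B (N - 1 + M) = B (N - 1) * ∏ m ∈ range M, br (m + N) := by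
      simp only [B, prod_range_add]
      congr 1
      refine prod_congr rfl fun m _ => congrArg br (by omega)
    rw [hB, mul_comm (br N ^ W M), mul_div_mul_left _ _ (hBne _)]
    simp only [hfactor, prod_div_distrib, prod_pow_eq_pow_sum, hWsum]
  have hΓprod : ∀ D i, i ≤ N - 1 → 1 ≤ D →
      (∏ k ∈ range (i + 1), Γ D k) * ∏ k ∈ Icc (i + 1) (N - 1), Γ (D - 1) k
        = br N ^ W (N * (D - 1) + (i + 1)) * B (N - 1) / B (N * D + i) := by
    intro D i hi hD
    obtain ⟨D, rfl⟩ := Nat.exists_eq_add_of_le' hD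
    have hIcc : Icc (i + 1) (N - 1) = Ico (i + 1) N := by
      ext k
      simp only [mem_Icc, mem_Ico]
      omega
    simp only [hΓrange, hIcc, Nat.add_sub_cancel]
    rw [prod_range_mul_add_eq_prod_prod (by omega) D fun m => 1 - br m / br (m + N), hprod]
    congr 2
    rw [Nat.mul_succ]
    omega
  have hL : ∀ n, 1 ≤ n → Lf (η ^ q ^ 2) n
      = B n * ((θ - η) ^ (q * W n) * (θ - η ^ q)
        / ((θ - η ^ q ^ 2) ^ W n * (θ - η ^ q) ^ q ^ n)) := by
    intro n hn
    obtain ⟨n, rfl⟩ := Nat.exists_eq_add_of_le' hn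
    have hres : ∏ k ∈ range N, (θ - η ^ q ^ (k + 2)) ^ ((n + 1 + N - k - 2) / N)
        = ∏ t ∈ range n, (θ - η ^ q ^ (t + 2)) := by
      rw [prod_range_eq_prod_pow_of_periodic (N := N) (by omega) fun t => θ - η ^ q ^ (t + 2)]
      · refine prod_congr rfl fun k _ => ?_
        congr 2
        omega
      · intro t
        simp only [add_right_comm t N 2, hshift]
    have hpow : ∀ k, (η ^ q ^ 2) ^ q ^ k = η ^ q ^ (k + 2) := fun k => by
      rw [← pow_mul, ← pow_add, add_comm]
    have hlast : η ^ q ^ (N - 1 + 2) = η ^ q := by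
      rw [show N - 1 + 2 = 1 + N by omega, hshift, pow_one]
    have hBn : B (n + 1) = (∏ m ∈ range (n + 1), (θ - θ ^ q ^ (m + 1)))
        / ((θ - η) ^ (q * W (n + 1))
          * ((∏ t ∈ range n, (θ - η ^ q ^ (t + 2))) * (θ - η ^ q))) := by
      have hexp : ∑ m ∈ range (n + 1), q ^ (m + 1) = q * W (n + 1) := by
        simp only [hWsum, mul_sum, pow_succ']
      simp only [B, hbrdiv, prod_div_distrib, prod_mul_distrib, prod_pow_eq_pow_sum, hexp]
      rw [prod_range_succ' (fun m => θ - η ^ q ^ (m + 1)), zero_add, pow_one]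
    have hTne : ∏ t ∈ range n, (θ - η ^ q ^ (t + 2)) ≠ 0 := prod_ne_zero_iff.2 fun t _ => hne _
    have hne1 : θ - η ^ q ≠ 0 := by simpa using hne 1
    have hne2 := hne 2
    rw [hLf _ _ (by omega)]
    simp only [hpow, hlast]
    rw [prod_inv_distrib, hres, prod_Icc_one_eq_prod_range, hBn]
    field_simp
  have hne1 : θ - η ^ q ≠ 0 := by simpa using hne 1
  have hne2 := hne 2
  have hdl : 1 ≤ d - l := by omega
  have hNle : N ≤ N * (d - l) := Nat.le_mul_of_pos_right N hdl
  have hden : Γ d 0 * Γ d 1 * ∏ k ∈ Icc 2 (N - 1), Γ (d - 1) k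
      = br N ^ W (N * (d - 1) + 2) * B (N - 1) / B (N * d + 1) := by
    simpa [prod_range_succ] using hΓprod d 1 (by omega) hd
  rw [hden, hΓprod (d - l) i hi hdl, hA, hdecomp, hL _ (by omega), hL _ (by omega)]
  have hn : N * d + 1 = j + (N * (d - l) + i) := by omega
  have hM : N * (d - 1) + 2 = j + (N * (d - l - 1) + (i + 1)) := by
    have h1 : N * d = N * (d - 1) + N := by
      rw [← Nat.mul_succ, Nat.succ_eq_add_one, Nat.sub_add_cancel hd]
    have h2 : N * (d - l) = N * (d - l - 1) + N := by
      rw [← Nat.mul_succ, Nat.succ_eq_add_one, Nat.sub_add_cancel hdl]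
    omega
  rw [hn, hM]
  have hzpow : B (N - 1) ^ ((1 : ℤ) - (q : ℤ) ^ j) = B (N - 1) / B (N - 1) ^ q ^ j := by
    rw [zpow_sub₀ (hBne _), zpow_one]
    norm_cast
  rw [hzpow]
  generalize N * (d - l) + i = n
  generalize N * (d - l - 1) + (i + 1) = M
  obtain ⟨r, hr⟩ := Nat.exists_eq_add_of_le' (Nat.one_le_pow j q (by omega))
  rw [hWadd j n, hWadd j M, mul_add q (W j), hqW j, pow_add q j n, hr, Nat.add_sub_cancel]
  have hbN := hbrne N (by omega)
  have hb₀ := hBne (N - 1)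
  have hb₁ := hBne n
  have hb₂ := hBne (j + n)
  generalize q ^ n = Q
  generalize B (N - 1) = b₀ at hb₀ ⊢
  generalize B n = b₁ at hb₁ ⊢
  generalize B (j + n) = b₂ at hb₂ ⊢
  generalize br N = c at hbN ⊢
  generalize θ - η = x₀ at hne0 ⊢
  generalize θ - η ^ q = x₁ at hne1 ⊢
  generalize θ - η ^ q ^ 2 = x₂ at hne2 ⊢
  simp only [div_pow, mul_pow, ← pow_mul]
  field_simp
  ring
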